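/- Let V be an n-dimensional complex vector space with Hermitian inner product, and let ω ∈ Λ^{1,1}V* be the associated positive (1,1)-form. Then the linear map Λ^{n−1}V*_ℂ → Λ^{n+1}V*_ℂ given by φ ↦ ω ∧ φ is bijective. -/

import Mathlib

open ExteriorAlgebra

namespace LefAux

variable {W : Type*} [AddCommGroup W] [Module ℝ W]

/-- Contraction on the exterior algebra. -/
noncomputable def ctr (d : Module.Dual ℝ W) : ExteriorAlgebra ℝ W →ₗ[ℝ] ExteriorAlgebra ℝ W :=
  CliffordAlgebra.contractLeft d

theorem ctr_mul (d : Module.Dual ℝ W) (v : W) (x : ExteriorAlgebra ℝ W) :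
    ctr d (ι ℝ v * x) = d v • x - ι ℝ v * ctr d x :=
  CliffordAlgebra.contractLeft_ι_mul ..

theorem ctr_zero (d : Module.Dual ℝ W) {x : ExteriorAlgebra ℝ W} (hx : x ∈ ⋀[ℝ]^0 W) :
    ctr d x = 0 := by
  rw [exteriorPower, pow_zero, Submodule.mem_one] at hx
  obtain ⟨r, rfl⟩ := hx
  exact CliffordAlgebra.contractLeft_algebraMap ..

theorem ext_ind {k : ℕ} {P : ExteriorAlgebra ℝ W → Prop}
    (hm : ∀ v, ∀ x ∈ ⋀[ℝ]^k W, P (ι ℝ v * x)) (ha : ∀ x y, P x → P y → P (x + y))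
    {x : ExteriorAlgebra ℝ W} (hx : x ∈ ⋀[ℝ]^(k + 1) W) : P x := by
  rw [exteriorPower, pow_succ'] at hx
  refine Submodule.mul_induction_on hx ?_ ha
  rintro _ ⟨v, rfl⟩ y hy
  exact hm v y hy

theorem mul_mem {k : ℕ} (v : W) {x : ExteriorAlgebra ℝ W} (hx : x ∈ ⋀[ℝ]^k W) :
    ι ℝ v * x ∈ ⋀[ℝ]^(k + 1) W := by
  rw [exteriorPower, pow_succ']
  exact Submodule.mul_mem_mul ⟨v, rfl⟩ hx

theorem ctr_mem (d : Module.Dual ℝ W) (k : ℕ) :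
    ∀ x ∈ ⋀[ℝ]^(k + 1) W, ctr d x ∈ ⋀[ℝ]^k W := by
  induction k with
  | zero =>
    intro x hx
    refine ext_ind (P := fun x => ctr d x ∈ ⋀[ℝ]^0 W) ?_ ?_ hx
    · intro v x hx
      rw [ctr_mul, ctr_zero d hx, mul_zero, sub_zero]
      exact Submodule.smul_mem _ _ hx
    · intro x y hx hy
      rw [map_add]
      exact Submodule.add_mem _ hx hy
  | succ k ih =>
    intro x hx
    refine ext_ind (P := fun x => ctr d x ∈ ⋀[ℝ]^(k + 1) W) ?_ ?_ hx
    · intro v x hx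
      rw [ctr_mul]
      exact Submodule.sub_mem _ (Submodule.smul_mem _ _ hx) (mul_mem v (ih x hx))
    · intro x y hx hy
      rw [map_add]
      exact Submodule.add_mem _ hx hy

variable {n : ℕ} (e f : Fin n → W) (p q : Fin n → Module.Dual ℝ W)

/-- The Lefschetz operator. -/
noncomputable def L : ExteriorAlgebra ℝ W →ₗ[ℝ] ExteriorAlgebra ℝ W :=
  LinearMap.mulLeft ℝ (∑ i, ι ℝ (e i) * ι ℝ (f i))

/-- The dual Lefschetz operator. -/
noncomputable def Lam : ExteriorAlgebra ℝ W →ₗ[ℝ] ExteriorAlgebra ℝ W :=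
  ∑ i, (ctr (q i)) ∘ₗ (ctr (p i))

theorem L_apply (x : ExteriorAlgebra ℝ W) :
    L e f x = ∑ i, ι ℝ (e i) * (ι ℝ (f i) * x) := by
  simp [L, Finset.sum_mul, mul_assoc]

theorem Lam_apply (x : ExteriorAlgebra ℝ W) :
    Lam p q x = ∑ i, ctr (q i) (ctr (p i) x) := by
  simp [Lam]

theorem L_mem {k : ℕ} {x : ExteriorAlgebra ℝ W} (hx : x ∈ ⋀[ℝ]^k W) :
    L e f x ∈ ⋀[ℝ]^(k + 2) W := by
  rw [L_apply]
  exact Submodule.sum_mem _ fun i _ => mul_mem _ (mul_mem _ hx)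

theorem Lam_mem {k : ℕ} {x : ExteriorAlgebra ℝ W} (hx : x ∈ ⋀[ℝ]^(k + 2) W) :
    Lam p q x ∈ ⋀[ℝ]^k W := by
  rw [Lam_apply]
  exact Submodule.sum_mem _ fun i _ => ctr_mem _ _ _ (ctr_mem _ _ _ hx)

theorem Lam_zero {k : ℕ} (hk : k < 2) {x : ExteriorAlgebra ℝ W} (hx : x ∈ ⋀[ℝ]^k W) :
    Lam p q x = 0 := by
  rw [Lam_apply]
  refine Finset.sum_eq_zero fun i _ => ?_
  match k, hk with
  | 0, _ => rw [ctr_zero _ hx, map_zero]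
  | 1, _ => exact ctr_zero _ (ctr_mem _ _ _ hx)

theorem number (hv : ∀ v, v = ∑ i, (p i v • e i + q i v • f i)) (k : ℕ) :
    ∀ x ∈ ⋀[ℝ]^k W,
      ∑ i, (ι ℝ (e i) * ctr (p i) x + ι ℝ (f i) * ctr (q i) x) = (k : ℝ) • x := by
  induction k with
  | zero =>
    intro x hx
    simp [ctr_zero _ hx]
  | succ k ih =>
    intro x hx
    refine ext_ind (P := fun x => ∑ i, (ι ℝ (e i) * ctr (p i) x + ι ℝ (f i) * ctr (q i) x)
      = ((k + 1 : ℕ) : ℝ) • x) ?_ ?_ hx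
    · intro v x hx
      have anti : ∀ a b : W, ∀ z : ExteriorAlgebra ℝ W,
          ι ℝ a * (ι ℝ b * z) = - (ι ℝ b * (ι ℝ a * z)) := by
        intro a b z
        rw [← mul_assoc, ← mul_assoc, ← neg_mul]
        congr 1
        exact eq_neg_of_add_eq_zero_left (ι_add_mul_swap a b)
      have h1 : ∀ i, ι ℝ (e i) * ctr (p i) (ι ℝ v * x) + ι ℝ (f i) * ctr (q i) (ι ℝ v * x)
          = ι ℝ (p i v • e i + q i v • f i) * x
            + ι ℝ v * (ι ℝ (e i) * ctr (p i) x + ι ℝ (f i) * ctr (q i) x) := by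
        intro i
        rw [ctr_mul, ctr_mul, mul_sub, mul_sub, anti (e i) v, anti (f i) v]
        simp only [map_add, map_smul, mul_add, add_mul, mul_smul_comm, smul_mul_assoc]
        abel
      rw [Finset.sum_congr rfl fun i _ => h1 i, Finset.sum_add_distrib, ← Finset.sum_mul,
        ← map_sum, ← hv v, ← Finset.mul_sum, ih x hx]
      push_cast
      rw [mul_smul_comm, add_smul, one_smul, add_comm]
    · intro x y hx hy
      rw [smul_add, ← hx, ← hy, ← Finset.sum_add_distrib]
      refine Finset.sum_congr rfl fun i _ => ?_
      simp only [map_add, mul_add]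
      abel

theorem comm (hv : ∀ v, v = ∑ i, (p i v • e i + q i v • f i))
    (hpe : ∀ i j, p i (e j) = if i = j then 1 else 0) (hpf : ∀ i j, p i (f j) = 0)
    (hqe : ∀ i j, q i (e j) = 0) (hqf : ∀ i j, q i (f j) = if i = j then 1 else 0)
    {k : ℕ} {x : ExteriorAlgebra ℝ W} (hx : x ∈ ⋀[ℝ]^k W) :
    L e f (Lam p q x) = Lam p q (L e f x) + ((k : ℝ) - n) • x := by
  have h1 : ∀ i j, ctr (q j) (ctr (p j) (ι ℝ (e i) * (ι ℝ (f i) * x)))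
      = ι ℝ (e i) * (ι ℝ (f i) * ctr (q j) (ctr (p j) x))
        + if j = i then x - (ι ℝ (e i) * ctr (p i) x + ι ℝ (f i) * ctr (q i) x) else 0 := by
    intro i j
    by_cases h : j = i
    · subst h
      simp only [ctr_mul, hpe, hpf, hqe, hqf, if_true, map_sub, one_smul, zero_smul, mul_sub,
        mul_zero, map_zero]
      simp only [zero_sub, sub_neg_eq_add]
      abel
    · simp [ctr_mul, hpe, hpf, hqe, hqf, h]
  have h2 : Lam p q (L e f x) = L e f (Lam p q x)
      + ∑ i, (x - (ι ℝ (e i) * ctr (p i) x + ι ℝ (f i) * ctr (q i) x)) := by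
    simp only [Lam_apply, L_apply, map_sum, h1, Finset.sum_add_distrib]
    congr 1
    · exact Finset.sum_comm
    · simp
  rw [h2, Finset.sum_sub_distrib, number e f p q hv k x hx]
  rw [Finset.sum_const, Finset.card_univ, Fintype.card_fin, ← Nat.cast_smul_eq_nsmul ℝ, sub_smul]
  abel

theorem inj (hv : ∀ v, v = ∑ i, (p i v • e i + q i v • f i))
    (hpe : ∀ i j, p i (e j) = if i = j then 1 else 0) (hpf : ∀ i j, p i (f j) = 0)
    (hqe : ∀ i j, q i (e j) = 0) (hqf : ∀ i j, q i (f j) = if i = j then 1 else 0)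
    (hn : 0 < n) {x : ExteriorAlgebra ℝ W} (hx : x ∈ ⋀[ℝ]^(n - 1) W) (h0 : L e f x = 0) :
    x = 0 := by
  have hmem : ∀ j, (2 * j ≤ n - 1 → ((Lam p q) ^ j) x ∈ ⋀[ℝ]^(n - 1 - 2 * j) W) ∧
      (n - 1 < 2 * j → ((Lam p q) ^ j) x = 0) := by
    intro j
    induction j with
    | zero => exact ⟨fun _ => hx, fun h => by omega⟩
    | succ j ih =>
      rw [pow_succ', Module.End.mul_apply]
      refine ⟨fun h => ?_, fun h => ?_⟩
      · have := ih.1 (by omega)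
        rw [show n - 1 - 2 * j = n - 1 - 2 * (j + 1) + 2 by omega] at this
        exact Lam_mem _ _ this
      · by_cases h' : 2 * j ≤ n - 1
        · exact Lam_zero _ _ (by omega) (ih.1 h')
        · rw [ih.2 (by omega), map_zero]
  have hL : ∀ j : ℕ, L e f (((Lam p q) ^ (j + 1)) x) = (-((j : ℝ) + 1) ^ 2) • ((Lam p q) ^ j) x := by
    have hstep : ∀ j : ℕ, L e f (((Lam p q) ^ (j + 1)) x) =
        Lam p q (L e f (((Lam p q) ^ j) x)) + (-1 - 2 * (j : ℝ)) • ((Lam p q) ^ j) x := by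
      intro j
      rw [pow_succ', Module.End.mul_apply]
      by_cases h' : 2 * j ≤ n - 1
      · rw [comm e f p q hv hpe hpf hqe hqf ((hmem j).1 h')]
        congr 2
        rw [Nat.cast_sub h', Nat.cast_sub (by omega)]
        push_cast
        ring
      · simp [(hmem j).2 (by omega)]
    intro j
    induction j with
    | zero => rw [hstep]; simp [h0]
    | succ j ih =>
      rw [hstep, ih, map_smul, ← Module.End.mul_apply, ← pow_succ', ← add_smul]
      congr 1
      push_cast
      ring
  have hdesc : ∀ j, ((Lam p q) ^ j) x = 0 → x = 0 := by
    intro j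
    induction j with
    | zero => exact fun h => h
    | succ j ih =>
      intro h
      apply ih
      have := hL j
      rw [h, map_zero] at this
      refine (smul_eq_zero.mp this.symm).resolve_left ?_
      have : (0 : ℝ) < (j : ℝ) + 1 := by positivity
      exact neg_ne_zero.mpr (pow_ne_zero _ this.ne')
  exact hdesc n ((hmem n).2 (by omega))

theorem bij [Module.Finite ℝ W] (hd : Module.finrank ℝ W = 2 * n)
    (hv : ∀ v, v = ∑ i, (p i v • e i + q i v • f i))
    (hpe : ∀ i j, p i (e j) = if i = j then 1 else 0) (hpf : ∀ i j, p i (f j) = 0)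
    (hqe : ∀ i j, q i (e j) = 0) (hqf : ∀ i j, q i (f j) = if i = j then 1 else 0)
    (hn : 0 < n) :
    Set.BijOn (L e f) (↑(⋀[ℝ]^(n - 1) W) : Set (ExteriorAlgebra ℝ W))
      (↑(⋀[ℝ]^(n + 1) W) : Set (ExteriorAlgebra ℝ W)) := by
  have hmaps : ∀ x ∈ ⋀[ℝ]^(n - 1) W, L e f x ∈ ⋀[ℝ]^(n + 1) W := by
    intro x hx
    have := L_mem e f hx
    rwa [show n - 1 + 2 = n + 1 by omega] at this
  have hinj : Function.Injective ((L e f).restrict hmaps) := by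
    rw [injective_iff_map_eq_zero]
    intro x hx
    exact Subtype.ext (inj e f p q hv hpe hpf hqe hqf hn x.2 (congrArg Subtype.val hx))
  have hfr : Module.finrank ℝ (⋀[ℝ]^(n - 1) W) = Module.finrank ℝ (⋀[ℝ]^(n + 1) W) := by
    rw [exteriorPower.finrank_eq, exteriorPower.finrank_eq, hd]
    exact Nat.choose_symm_of_eq_add (by omega)
  have hsurj := (LinearMap.injective_iff_surjective_of_finrank_eq_finrank hfr).mp hinj
  refine ⟨hmaps, fun x hx y hy h => ?_, fun y hy => ?_⟩
  · exact congrArg Subtype.val (@hinj ⟨x, hx⟩ ⟨y, hy⟩ (Subtype.ext h))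
  · obtain ⟨x, hx⟩ := hsurj ⟨y, hy⟩
    exact ⟨x, x.2, congrArg Subtype.val hx⟩

end LefAux

/-- Pointwise hard Lefschetz bijectivity in middle-adjacent degree: on an `n`-dimensional
Hermitian vector space `V`, wedging with the fundamental `(1,1)`-form
`Ω = ∑ᵢ eᵢ ∧ (i·eᵢ)` (for an orthonormal basis `e`) is a bijection from the `(n−1)`-st
onto the `(n+1)`-st exterior power (of the underlying real vector space, identified with
covectors via the metric). -/
theorem lefschetz_wedge_bijective
    {V : Type*} [NormedAddCommGroup V] [InnerProductSpace ℂ V] [FiniteDimensional ℂ V]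
    (n : ℕ) (hn : n = Module.finrank ℂ V) (hn0 : 0 < n)
    (b : OrthonormalBasis (Fin n) ℂ V)
    (Ω : ExteriorAlgebra ℝ V)
    (hΩ : Ω = ∑ i, ι ℝ (b i) * ι ℝ ((Complex.I : ℂ) • b i)) :
    Set.BijOn (fun x => Ω * x)
      (↑(⋀[ℝ]^(n - 1) V) : Set (ExteriorAlgebra ℝ V))
      (↑(⋀[ℝ]^(n + 1) V) : Set (ExteriorAlgebra ℝ V)) := by
  subst hΩ
  have : Module.Finite ℝ V := FiniteDimensional.complexToReal V
  let c : Fin n → V →ₗ[ℂ] ℂ := fun i => b.toBasis.coord i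
  have hc : ∀ i j, c i (b j) = if i = j then 1 else 0 := by
    intro i j
    have := b.toBasis.repr_self_apply j i
    simp only [OrthonormalBasis.coe_toBasis] at this
    simp only [c, Module.Basis.coord_apply, this, eq_comm]
  refine LefAux.bij (fun i => b i) (fun i => Complex.I • b i)
    (fun i => Complex.reLm ∘ₗ (c i).restrictScalars ℝ)
    (fun i => Complex.imLm ∘ₗ (c i).restrictScalars ℝ) ?_ ?_ ?_ ?_ ?_ ?_ hn0
  · rw [finrank_real_of_complex, hn]
  · intro v
    conv_lhs => rw [← b.toBasis.sum_repr v]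
    refine Finset.sum_congr rfl fun i _ => ?_
    simp only [LinearMap.comp_apply, LinearMap.restrictScalars_apply, c, Module.Basis.coord_apply,
      OrthonormalBasis.coe_toBasis, Complex.reLm_coe, Complex.imLm_coe]
    rw [← Complex.coe_smul, ← Complex.coe_smul, smul_smul, ← add_smul, Complex.re_add_im]
  · intro i j
    simp only [LinearMap.comp_apply, LinearMap.restrictScalars_apply, hc]
    split_ifs <;> simp
  · intro i j
    simp only [LinearMap.comp_apply, LinearMap.restrictScalars_apply, map_smul, hc]
    split_ifs <;> simp
  · intro i j
    simp only [LinearMap.comp_apply, LinearMap.restrictScalars_apply, hc]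
    split_ifs <;> simp
  · intro i j
    simp only [LinearMap.comp_apply, LinearMap.restrictScalars_apply, map_smul, hc]
    split_ifs <;> simp
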